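/- Under the protocol, for every t ≥ 1 there exists an n×n real matrix A(t−1) which is symmetric, stochastic (nonnegative entries with every row summing to 1), and diagonally dominant (each diagonal entry is at least the sum of the absolute values of the other entries in its row), such that every strictly positive off-diagonal entry satisfies a_{ij}(t−1) ≥ 1/(8 D(i,j,t)), a_{ij}(t−1) > 0 for i ≠ j only if j ∈ S(i,t), and the protocol update can be written in matrix form as x(t) = (1 − t^{−β}) x(t−1) + t^{−β} A(t−1) x(t−1). -/

import Mathlib

open scoped Classical

noncomputable section

/-- The rounding function `R` sending `x` to `1`, `0`, `-1` according to `x > 1`,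
`-1 ≤ x ≤ 1`, `x < -1`. -/
def Rq (y : ℝ) : ℝ := if y > 1 then 1 else if y < -1 then -1 else 0

/-- The data and evolution equations of the ternary-message average-consensus protocol
on `n` nodes.  `E t i j` means the edge `(i,j)` is present in the graph `G(t)`
(for `t ≥ 1`); `x t i` is the value of node `i` at time `t`; `xin t i j` is
`x̂_{i,j,in}(t)`, `xout t i j` is `x̂_{i,j,out}(t)` and `q t i j` is `q_{i→j}(t)`. -/
structure Protocol (n : ℕ) where
  α : ℝ
  β : ℝ
  hα : 0 < α
  hαβ : α < β
  hβ : β < 1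
  E : ℕ → Fin n → Fin n → Prop
  Esymm : ∀ t i j, E t i j → E t j i
  Eirrefl : ∀ t i, ¬ E t i i
  D : Fin n → Fin n → ℕ → ℝ
  Dsymm : ∀ i j t, D i j t = D j i t
  Dbound : ∀ t i j, E t i j →
    ((max (Set.ncard {k | E t i k}) (Set.ncard {k | E t j k}) : ℕ) : ℝ) ≤ D i j t
  x : ℕ → Fin n → ℝ
  xin : ℕ → Fin n → Fin n → ℝ
  xout : ℕ → Fin n → Fin n → ℝ
  q : ℕ → Fin n → Fin n → ℝ
  hxin0 : ∀ i j, xin 0 i j = 0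
  hxout0 : ∀ i j, xout 0 i j = 0
  hq : ∀ t, 1 ≤ t → ∀ i j, E t i j →
    q t i j = Rq ((t : ℝ) ^ α * (x (t - 1) i - xout (t - 1) i j))
  hxoutE : ∀ t, 1 ≤ t → ∀ i j, E t i j →
    xout t i j = xout (t - 1) i j + q t i j / (t : ℝ) ^ α
  hxinE : ∀ t, 1 ≤ t → ∀ i j, E t i j →
    xin t i j = xin (t - 1) i j + q t j i / (t : ℝ) ^ α
  hxoutN : ∀ t, 1 ≤ t → ∀ i j, ¬ E t i j → xout t i j = xout (t - 1) i j
  hxinN : ∀ t, 1 ≤ t → ∀ i j, ¬ E t i j → xin t i j = xin (t - 1) i j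
  hx : ∀ t, 1 ≤ t → ∀ i, x t i = x (t - 1) i + (1 / (t : ℝ) ^ β) *
    ∑ j ∈ Finset.univ.filter (fun j => E t i j ∧
        4 / (t : ℝ) ^ α < |xin t i j - xout t i j| ∧ q t j i = 0 ∧ q t i j = 0),
      (xin t i j - xout t i j) / (4 * D i j t)

namespace Protocol

variable {n : ℕ} (P : Protocol n)

/-- The set `S(i,t)` of neighbors that node `i` includes in its update at time `t`. -/
def S (t : ℕ) (i : Fin n) : Finset (Fin n) :=
  Finset.univ.filter (fun j => P.E t i j ∧
    4 / (t : ℝ) ^ P.α < |P.xin t i j - P.xout t i j| ∧ P.q t j i = 0 ∧ P.q t i j = 0)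

/-- The graph sequence of the protocol is `B`-core-connected with core edge
relation `Einf`: every core edge appears at some time, the graph of core edges is
connected, and every core edge appears in every time window `[kB+1, (k+1)B]`. -/
def CoreConnected (B : ℕ) (Einf : Fin n → Fin n → Prop) : Prop :=
  (∀ i j, Einf i j → ∃ t, 1 ≤ t ∧ P.E t i j) ∧
  (SimpleGraph.fromRel Einf).Connected ∧
  ∀ k : ℕ, ∀ i j, Einf i j → ∃ t, k * B + 1 ≤ t ∧ t ≤ (k + 1) * B ∧ P.E t i j

end Protocol

/-- `M(x)`: the largest coordinate. -/
def maxV {n : ℕ} (y : Fin n → ℝ) : ℝ := ⨆ i, y i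

/-- `m(x)`: the smallest coordinate. -/
def minV {n : ℕ} (y : Fin n → ℝ) : ℝ := ⨅ i, y i

/-- `W(x) = M(x) - m(x)`. -/
def Wsp {n : ℕ} (y : Fin n → ℝ) : ℝ := maxV y - minV y

/-- The sup norm `‖x‖_∞ = max_i |x_i|`. -/
def normInf {n : ℕ} (y : Fin n → ℝ) : ℝ := ⨆ i, |y i|

/-- `V2(x) = sqrt(Σ_i (x_i - (1/n) Σ_j x_j)²)`. -/
def V2 {n : ℕ} (y : Fin n → ℝ) : ℝ :=
  Real.sqrt (∑ i, (y i - (∑ j, y j) / n) ^ 2)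

namespace Protocol

variable {n : ℕ} (P : Protocol n)

theorem xin_eq_xout_swap (t : ℕ) (i j : Fin n) : P.xin t i j = P.xout t j i := by
  induction t with
  | zero => rw [P.hxin0, P.hxout0]
  | succ t ih =>
    have ht : 1 ≤ t + 1 := Nat.le_add_left 1 t
    by_cases h : P.E (t + 1) i j
    · rw [P.hxinE _ ht i j h, P.hxoutE _ ht j i (P.Esymm _ _ _ h), Nat.add_sub_cancel, ih]
    · rw [P.hxinN _ ht i j h, P.hxoutN _ ht j i (fun h' => h (P.Esymm _ _ _ h')),
        Nat.add_sub_cancel, ih]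

theorem abs_le_one_of_Rq_eq_zero {y : ℝ} (h : Rq y = 0) : |y| ≤ 1 := by
  unfold Rq at h
  split_ifs at h with h₁ h₂
  · norm_num at h
  · norm_num at h
  · exact abs_le.2 ⟨not_lt.1 h₂, not_lt.1 h₁⟩

theorem abs_x_sub_xout_le {t : ℕ} (ht : 1 ≤ t) {i j : Fin n} (hE : P.E t i j)
    (hq : P.q t i j = 0) :
    |P.x (t - 1) i - P.xout t i j| ≤ 1 / (t : ℝ) ^ P.α := by
  have hpos : 0 < (t : ℝ) ^ P.α := Real.rpow_pos_of_pos (by exact_mod_cast ht) _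
  have h := P.hq t ht i j hE
  rw [hq] at h
  have h' := abs_le_one_of_Rq_eq_zero h.symm
  rw [abs_mul, abs_of_pos hpos] at h'
  rw [P.hxoutE t ht i j hE, hq, zero_div, add_zero, le_div_iff₀ hpos, mul_comm]
  exact h'

theorem mem_S {t : ℕ} {i j : Fin n} : j ∈ P.S t i ↔ P.E t i j ∧
    4 / (t : ℝ) ^ P.α < |P.xin t i j - P.xout t i j| ∧ P.q t j i = 0 ∧ P.q t i j = 0 := by
  simp [S]

theorem mem_S_comm {t : ℕ} {i j : Fin n} : j ∈ P.S t i ↔ i ∈ P.S t j := by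
  rw [mem_S, mem_S, P.xin_eq_xout_swap t i j, P.xin_eq_xout_swap t j i,
    abs_sub_comm (P.xout t j i)]
  exact ⟨fun ⟨a, b, c, d⟩ => ⟨P.Esymm _ _ _ a, b, d, c⟩,
    fun ⟨a, b, c, d⟩ => ⟨P.Esymm _ _ _ a, b, d, c⟩⟩

theorem card_S_le_D {t : ℕ} {i j : Fin n} (hE : P.E t i j) :
    ((P.S t i).card : ℝ) ≤ P.D i j t := by
  refine le_trans ?_ (P.Dbound t i j hE)
  norm_cast
  refine le_trans ?_ (le_max_left _ _)
  rw [← Set.ncard_coe_finset]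
  exact Set.ncard_le_ncard (fun k hk => (P.mem_S.1 hk).1) (Set.toFinite _)

theorem D_pos {t : ℕ} {i j : Fin n} (hj : j ∈ P.S t i) : 0 < P.D i j t :=
  lt_of_lt_of_le (by exact_mod_cast Finset.card_pos.2 ⟨j, hj⟩) (P.card_S_le_D (P.mem_S.1 hj).1)

theorem ratio_bounds {u v ε : ℝ} (hε : 0 < ε) (hu : 4 * ε < |u|) (huv : |v - u| ≤ 2 * ε) :
    v ≠ 0 ∧ 1 / 2 ≤ u / v ∧ u / v ≤ 2 := by
  obtain ⟨h₁, h₂⟩ := abs_le.1 huv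
  rcases lt_abs.1 hu with h | h
  · have hv : 0 < v := by linarith
    exact ⟨hv.ne', by rw [le_div_iff₀ hv]; linarith, by rw [div_le_iff₀ hv]; linarith⟩
  · have hv : v < 0 := by linarith
    exact ⟨hv.ne, by rw [le_div_iff_of_neg hv]; linarith, by rw [div_le_iff_of_neg hv]; linarith⟩

theorem estimate_ratio_bounds {t : ℕ} (ht : 1 ≤ t) {i j : Fin n} (hj : j ∈ P.S t i) :
    P.x (t - 1) j - P.x (t - 1) i ≠ 0 ∧
    1 / 2 ≤ (P.xin t i j - P.xout t i j) / (P.x (t - 1) j - P.x (t - 1) i) ∧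
    (P.xin t i j - P.xout t i j) / (P.x (t - 1) j - P.x (t - 1) i) ≤ 2 := by
  obtain ⟨hE, hgap, hqji, hqij⟩ := P.mem_S.1 hj
  have hpos : 0 < (t : ℝ) ^ P.α := Real.rpow_pos_of_pos (by exact_mod_cast ht) _
  obtain ⟨h₁, h₂⟩ := abs_le.1 (P.abs_x_sub_xout_le ht hE hqij)
  obtain ⟨h₃, h₄⟩ := abs_le.1 (P.abs_x_sub_xout_le ht (P.Esymm _ _ _ hE) hqji)
  refine ratio_bounds (ε := 1 / (t : ℝ) ^ P.α) (by positivity) (by rwa [mul_one_div]) ?_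
  rw [P.xin_eq_xout_swap, abs_le]
  constructor <;> linarith

/-- The weight node `i` effectively puts on the difference `x j - x i` in its update. -/
def weight (t : ℕ) (i j : Fin n) : ℝ :=
  if j ∈ P.S t i then
    (P.xin t i j - P.xout t i j) / (P.x (t - 1) j - P.x (t - 1) i) / (4 * P.D i j t)
  else 0

theorem weight_comm (t : ℕ) (i j : Fin n) : P.weight t i j = P.weight t j i := by
  unfold weight
  simp only [P.mem_S_comm (i := i)]
  rw [P.xin_eq_xout_swap t i j, P.xin_eq_xout_swap t j i, P.Dsymm i j,
    ← neg_sub (P.xout t i j), ← neg_sub (P.x (t - 1) i), neg_div_neg_eq]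

theorem weight_self (t : ℕ) (i : Fin n) : P.weight t i i = 0 :=
  if_neg fun h => P.Eirrefl t i (P.mem_S.1 h).1

theorem mem_S_of_weight_pos {t : ℕ} {i j : Fin n} (h : 0 < P.weight t i j) : j ∈ P.S t i := by
  by_contra hj
  simp [weight, hj] at h

theorem le_weight {t : ℕ} (ht : 1 ≤ t) {i j : Fin n} (hj : j ∈ P.S t i) :
    1 / (8 * P.D i j t) ≤ P.weight t i j := by
  have hD := P.D_pos hj
  rw [weight, if_pos hj]
  calc 1 / (8 * P.D i j t) = 1 / 2 / (4 * P.D i j t) := by field_simp; norm_num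
    _ ≤ _ := div_le_div_of_nonneg_right (P.estimate_ratio_bounds ht hj).2.1 (by positivity)

theorem weight_nonneg {t : ℕ} (ht : 1 ≤ t) (i j : Fin n) : 0 ≤ P.weight t i j := by
  by_cases hj : j ∈ P.S t i
  · have hD := P.D_pos hj
    exact le_trans (by positivity) (P.le_weight ht hj)
  · simp [weight, hj]

theorem sum_weight_le {t : ℕ} (ht : 1 ≤ t) (i : Fin n) : ∑ j, P.weight t i j ≤ 1 / 2 := by
  have hsum : ∑ j, P.weight t i j = ∑ j ∈ P.S t i, P.weight t i j :=
    (Finset.sum_subset (Finset.subset_univ _) fun j _ hj => if_neg hj).symm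
  rw [hsum]
  rcases (P.S t i).eq_empty_or_nonempty with h | h
  · simp [h]
  have hcard : (0 : ℝ) < (P.S t i).card := by exact_mod_cast Finset.card_pos.2 h
  calc ∑ j ∈ P.S t i, P.weight t i j ≤ ∑ j ∈ P.S t i, 2 / (4 * ((P.S t i).card : ℝ)) := by
        refine Finset.sum_le_sum fun j hj => ?_
        have hD := P.D_pos hj
        rw [weight, if_pos hj]
        gcongr
        · exact (P.estimate_ratio_bounds ht hj).2.2
        · exact P.card_S_le_D (P.mem_S.1 hj).1
    _ = 1 / 2 := by
        rw [Finset.sum_const, nsmul_eq_mul]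
        field_simp
        norm_num

theorem x_eq_add_sum_weight {t : ℕ} (ht : 1 ≤ t) (i : Fin n) :
    P.x t i = P.x (t - 1) i + (1 / (t : ℝ) ^ P.β) *
      ∑ j, P.weight t i j * (P.x (t - 1) j - P.x (t - 1) i) := by
  have hsum : ∑ j, P.weight t i j * (P.x (t - 1) j - P.x (t - 1) i) =
      ∑ j ∈ P.S t i, (P.xin t i j - P.xout t i j) / (4 * P.D i j t) := by
    rw [← Finset.sum_subset (Finset.subset_univ (P.S t i)) fun j _ hj => by simp [weight, hj]]
    refine Finset.sum_congr rfl fun j hj => ?_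
    have hv := (P.estimate_ratio_bounds ht hj).1
    rw [weight, if_pos hj, div_right_comm, div_mul_cancel₀ _ hv]
  rw [hsum, P.hx t ht i]
  rfl

end Protocol

/-- matrix form of the update: `x(t) = (1 - t^{-β}) x(t-1) + t^{-β} A(t-1) x(t-1)`
with `A(t-1)` symmetric, stochastic, diagonally dominant, positive off-diagonal entries
at least `1/(8 D(i,j,t))` and supported on `S(i,t)`. -/
theorem stmt5_matrix_form {n : ℕ} (hn : 1 ≤ n) (P : Protocol n)
    (t : ℕ) (ht : 1 ≤ t) :
    ∃ A : Matrix (Fin n) (Fin n) ℝ,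
      A.IsSymm ∧
      (∀ i j, 0 ≤ A i j) ∧
      (∀ i, ∑ j, A i j = 1) ∧
      (∀ i, ∑ j ∈ Finset.univ.erase i, |A i j| ≤ A i i) ∧
      (∀ i j, i ≠ j → 0 < A i j → 1 / (8 * P.D i j t) ≤ A i j ∧ j ∈ P.S t i) ∧
      ∀ i, P.x t i = (1 - 1 / (t : ℝ) ^ P.β) * P.x (t - 1) i +
        (1 / (t : ℝ) ^ P.β) * ∑ j, A i j * P.x (t - 1) j := by
  have hsum : ∀ (i : Fin n) (y : Fin n → ℝ),
      ∑ j, (P.weight t i j + if i = j then 1 - ∑ k, P.weight t i k else 0) * y j =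
        ∑ j, P.weight t i j * y j + (1 - ∑ k, P.weight t i k) * y i := fun i y => by
    simp [add_mul, Finset.sum_add_distrib]
  refine ⟨Matrix.of fun i j => P.weight t i j + if i = j then 1 - ∑ k, P.weight t i k else 0,
    ?_, ?_, ?_, ?_, ?_, ?_⟩
  · ext i j
    by_cases h : i = j
    · subst h
      rfl
    · simp [h, Ne.symm h, P.weight_comm t j i]
  · intro i j
    have h₁ := P.weight_nonneg ht i j
    have h₂ := P.sum_weight_le ht i
    simp only [Matrix.of_apply]
    split_ifs <;> linarith
  · intro i
    simpa using hsum i 1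
  · intro i
    have h₂ := P.sum_weight_le ht i
    have hoff : ∑ j ∈ Finset.univ.erase i,
        |P.weight t i j + if i = j then 1 - ∑ k, P.weight t i k else 0| =
        ∑ j, P.weight t i j := by
      rw [← Finset.sum_erase Finset.univ (P.weight_self t i)]
      refine Finset.sum_congr rfl fun j hj => ?_
      rw [if_neg (Finset.ne_of_mem_erase hj).symm, add_zero, abs_of_nonneg (P.weight_nonneg ht i j)]
    simp only [Matrix.of_apply]
    rw [hoff, if_true, P.weight_self]
    linarith
  · intro i j hij h
    simp only [Matrix.of_apply, if_neg hij, add_zero] at h ⊢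
    have hj := P.mem_S_of_weight_pos h
    exact ⟨P.le_weight ht hj, hj⟩
  · intro i
    simp only [Matrix.of_apply]
    rw [hsum, P.x_eq_add_sum_weight ht i]
    simp only [mul_sub, Finset.sum_sub_distrib, ← Finset.sum_mul]
    ring
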